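/- Let K ⊆ V* and K' ⊆ 𝕍 = V × V* be subspaces with K' ∩ V* = {0} and K ⊆ Ann(K + K'). Then the pairing ⟨,⟩ descends to a well-defined symmetric bilinear form on 𝕍'_K = Ann(K + K')/K, and this induced form is nondegenerate if and only if the restriction of ⟨,⟩ to K' is nondegenerate. (Equivalence of conditions (1') and (1'') in Lemma courant:missingrank.) -/

import Mathlib

/-- The generalized tangent space `𝕍 = V × V*`. -/
abbrev GV (V : Type*) [AddCommGroup V] [Module ℝ V] := V × Module.Dual ℝ V

variable (V : Type*) [AddCommGroup V] [Module ℝ V] [FiniteDimensional ℝ V]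

/-- The canonical symmetric pairing `⟨(X,ξ),(Y,η)⟩ = (1/2)(η X + ξ Y)` on `𝕍`. -/
noncomputable def pairForm : LinearMap.BilinForm ℝ (GV V) :=
  LinearMap.mk₂ ℝ (fun u v => (1 / 2 : ℝ) * (v.2 u.1 + u.2 v.1))
    (fun u u' v => by simp; ring)
    (fun c u v => by simp; ring)
    (fun u v v' => by simp; ring)
    (fun c u v => by simp; ring)

/-- `V* = {0} × V*` as a subspace of `𝕍`. -/
def VStar : Submodule ℝ (GV V) := LinearMap.range (LinearMap.inr ℝ V (Module.Dual ℝ V))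

variable {V}

/-- The annihilator of a subspace of `𝕍` with respect to the canonical pairing. -/
noncomputable def Ann (S : Submodule ℝ (GV V)) : Submodule ℝ (GV V) where
  carrier := {u : GV V | ∀ s ∈ S, pairForm V u s = 0}
  add_mem' := fun ha hb s hs => by simp [ha s hs, hb s hs]
  zero_mem' := fun s hs => by simp
  smul_mem' := fun c a ha s hs => by simp [ha s hs]

/-- The image in `𝕍` of a subspace `K ⊆ V*`. -/
def ofDual (K : Submodule ℝ (Module.Dual ℝ V)) : Submodule ℝ (GV V) :=
  K.map (LinearMap.inr ℝ V (Module.Dual ℝ V))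

/-- A linear generalized complex structure on `𝕍`. -/
structure IsGenCx (J : GV V →ₗ[ℝ] GV V) : Prop where
  sq : ∀ u, J (J u) = -u
  orth : ∀ u v, pairForm V (J u) (J v) = pairForm V u v

/-- A linear generalized Kähler structure on `𝕍`: two commuting linear generalized
complex structures such that `G = -J₁∘J₂` gives a positive definite form `⟨G·,·⟩`. -/
structure IsGenKahler (J₁ J₂ : GV V →ₗ[ℝ] GV V) : Prop where
  cx1 : IsGenCx J₁
  cx2 : IsGenCx J₂
  comm : ∀ u, J₁ (J₂ u) = J₂ (J₁ u)
  posdef : ∀ u : GV V, u ≠ 0 → 0 < pairForm V (-(J₁ (J₂ u))) u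

theorem pairForm_apply {V : Type*} [AddCommGroup V] [Module ℝ V] (u v : GV V) :
    pairForm V u v = (1 / 2 : ℝ) * (v.2 u.1 + u.2 v.1) := rfl

theorem pairForm_comm {V : Type*} [AddCommGroup V] [Module ℝ V] (u v : GV V) :
    pairForm V u v = pairForm V v u := by
  rw [pairForm_apply, pairForm_apply, add_comm]

theorem pairForm_isRefl {V : Type*} [AddCommGroup V] [Module ℝ V] :
    (pairForm V).IsRefl := fun u v h => by
  rw [pairForm_comm, h]

theorem pairForm_nondegenerate {V : Type*} [AddCommGroup V] [Module ℝ V] :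
    (pairForm V).Nondegenerate := by
  suffices h : (pairForm V).SeparatingLeft from
    ⟨h, fun v hv => h v fun u => by rw [pairForm_comm, hv u]⟩
  intro u h
  refine Prod.ext ?_ (LinearMap.ext fun X => ?_)
  · rw [Prod.fst_zero, ← Module.forall_dual_apply_eq_zero_iff ℝ]
    intro η
    simpa [pairForm_apply] using h (0, η)
  · simpa [pairForm_apply] using h (X, 0)

theorem mem_Ann {V : Type*} [AddCommGroup V] [Module ℝ V] {S : Submodule ℝ (GV V)} {u : GV V} :
    u ∈ Ann S ↔ ∀ s ∈ S, pairForm V u s = 0 := Iff.rfl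

theorem Ann_eq_orthogonal {V : Type*} [AddCommGroup V] [Module ℝ V] (S : Submodule ℝ (GV V)) :
    Ann S = (pairForm V).orthogonal S := by
  ext u
  rw [mem_Ann, LinearMap.BilinForm.mem_orthogonal_iff]
  exact forall₂_congr fun s _ => by
    rw [pairForm_comm]

theorem Ann_Ann {V : Type*} [AddCommGroup V] [Module ℝ V] [FiniteDimensional ℝ V]
    (S : Submodule ℝ (GV V)) : Ann (Ann S) = S := by
  rw [Ann_eq_orthogonal, Ann_eq_orthogonal,
    LinearMap.BilinForm.orthogonal_orthogonal pairForm_nondegenerate pairForm_isRefl]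

theorem ofDual_le_VStar {V : Type*} [AddCommGroup V] [Module ℝ V]
    (K : Submodule ℝ (Module.Dual ℝ V)) : ofDual K ≤ VStar V :=
  LinearMap.map_le_range

/-- equivalence of conditions (1') and (1'') in Lemma
courant:missingrank: if `K' ∩ V* = 0` and `K ⊆ Ann(K + K')`, then `⟨,⟩` descends
to a well-defined symmetric form on `𝕍'_K = Ann(K + K')/K` which is nondegenerate
iff the restriction of `⟨,⟩` to `K'` is nondegenerate. -/
theorem statement12 {V : Type*} [AddCommGroup V] [Module ℝ V] [FiniteDimensional ℝ V]
    (K : Submodule ℝ (Module.Dual ℝ V)) (K' : Submodule ℝ (GV V))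
    (hKV : K' ⊓ VStar V = ⊥)
    (hK : ofDual K ≤ Ann (ofDual K ⊔ K')) :
    let A : Submodule ℝ (GV V) := Ann (ofDual K ⊔ K')
    (∀ x ∈ A, ∀ x' ∈ A, ∀ y ∈ A, ∀ y' ∈ A,
      x - x' ∈ ofDual K → y - y' ∈ ofDual K →
        pairForm V x y = pairForm V x' y') ∧
    ((∀ x ∈ A, (∀ y ∈ A, pairForm V x y = 0) → x ∈ ofDual K) ↔
      (∀ x ∈ K', (∀ y ∈ K', pairForm V x y = 0) → x = 0)) := by
  intro A
  have left_zero : ∀ k ∈ ofDual K, ∀ y ∈ A, pairForm V k y = 0 := fun k hk y hy => by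
    rw [pairForm_comm]
    exact hy k (Submodule.mem_sup_left hk)
  refine ⟨fun x _ x' hx' y hy y' _ hx hy' => ?_, fun h x hx hxK' => ?_, fun h x hxA hx => ?_⟩
  · have h₁ := left_zero _ hx y hy
    have h₂ := left_zero _ hy' x' hx'
    rw [map_sub, LinearMap.sub_apply, sub_eq_zero] at h₁
    rw [pairForm_comm, map_sub, sub_eq_zero] at h₂
    exact h₁.trans h₂
  · have hxA : x ∈ A := by
      intro s hs
      obtain ⟨k, hk, k', hk', rfl⟩ := Submodule.mem_sup.1 hs
      rw [map_add, hxK' k' hk', add_zero, pairForm_comm]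
      exact hK hk x (Submodule.mem_sup_right hx)
    have hxK : x ∈ ofDual K := h x hxA fun y hy => by
      rw [pairForm_comm]
      exact hy x (Submodule.mem_sup_right hx)
    rw [← Submodule.mem_bot ℝ, ← hKV]
    exact ⟨hx, ofDual_le_VStar K hxK⟩
  · have hxS : x ∈ ofDual K ⊔ K' := by
      rw [← Ann_Ann (ofDual K ⊔ K')]
      exact hx
    obtain ⟨k, hk, k', hk', rfl⟩ := Submodule.mem_sup.1 hxS
    have hk'A : k' ∈ A := (A.add_mem_iff_right (hK hk)).1 hxA
    have hk'0 : k' = 0 := h k' hk' fun y hy => hk'A y (Submodule.mem_sup_right hy)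
    rwa [hk'0, add_zero]
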